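/- arXiv:math/0502234 — 3 statements merged into one kernel-verified Lean document; each statement's English description precedes it below -/
import Mathlib

section
/- Let A be the set of 2×2 matrices over 𝕄 = ℂ[t,t⁻¹] whose diagonal entries are balanced and whose off-diagonal entries are anti-balanced. Then A is a unital ℂ-subalgebra of the 2×2 matrix algebra M₂(𝕄), and there is an isomorphism of unital ℂ-algebras from the group algebra ℂ[D∞] of the infinite dihedral group D∞ = ℤ ⋊ ℤ/2ℤ (with the nontrivial element of ℤ/2ℤ acting on ℤ by negation) onto A, sending the generator of ℤ to the matrix with diagonal entries (t+t⁻¹)/2 and off-diagonal entries (t−t⁻¹)/2, and sending the generator of ℤ/2ℤ to the diagonal matrix diag(1,−1). -/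
open LaurentPolynomial

/-- The inversion automorphism `n ↦ -n` of `ℤ` (written multiplicatively). -/
def negAut : MulAut (Multiplicative ℤ) := MulEquiv.inv (Multiplicative ℤ)

lemma negAut_sq : negAut ^ 2 = 1 := by
  ext x
  simp [negAut, pow_two]

/-- The action of `ℤ/2ℤ` on `ℤ` in which the nontrivial element acts by
negation. -/
def negAction : Multiplicative (ZMod 2) →* MulAut (Multiplicative ℤ) where
  toFun g := negAut ^ (g.toAdd.val)
  map_one' := by simp
  map_mul' a b := by
    show negAut ^ ((a.toAdd + b.toAdd).val) = _
    rw [ZMod.val_add, ← pow_eq_pow_mod _ negAut_sq, pow_add]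

/-- The infinite dihedral group `D∞ = ℤ ⋊ ℤ/2ℤ`, the nontrivial element of
`ℤ/2ℤ` acting on `ℤ` by negation. -/
abbrev DInf : Type := Multiplicative ℤ ⋊[negAction] Multiplicative (ZMod 2)

/-- The matrices with balanced diagonal and anti-balanced off-diagonal entries. -/
noncomputable def balancedSubalgebra :
    Subalgebra ℂ (Matrix (Fin 2) (Fin 2) (LaurentPolynomial ℂ)) where
  carrier := {M | invert (M 0 0) = M 0 0 ∧ invert (M 1 1) = M 1 1 ∧
    invert (M 0 1) = -(M 0 1) ∧ invert (M 1 0) = -(M 1 0)}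
  mul_mem' := by
    rintro M N ⟨hM₀, hM₁, hM₂, hM₃⟩ ⟨hN₀, hN₁, hN₂, hN₃⟩
    simp only [Set.mem_ofPred_eq, Matrix.mul_apply, Fin.sum_univ_two, map_add, map_mul, *]
    refine ⟨?_, ?_, ?_, ?_⟩ <;> ring
  add_mem' := by
    rintro M N ⟨hM₀, hM₁, hM₂, hM₃⟩ ⟨hN₀, hN₁, hN₂, hN₃⟩
    simp only [Set.mem_ofPred_eq, Matrix.add_apply, map_add, neg_add_rev, add_comm, and_self, *]
  algebraMap_mem' r := by
    simp [Matrix.algebraMap_matrix_apply, LaurentPolynomial.algebraMap_apply]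

lemma two_mul_C_inv_two : (2 : LaurentPolynomial ℂ) * C (2⁻¹ : ℂ) = 1 := by
  rw [← map_ofNat (C : ℂ →+* LaurentPolynomial ℂ) 2, ← map_mul]
  simp

/-- The matrix `[[P₊, P₋], [P₋, P₊]]` formed from the balanced part `P₊` and the anti-balanced
part `P₋` of a Laurent polynomial `P`, as an algebra homomorphism. -/
noncomputable def circulantHom :
    LaurentPolynomial ℂ →ₐ[ℂ] Matrix (Fin 2) (Fin 2) (LaurentPolynomial ℂ) :=
  AlgHom.ofLinearMap
    { toFun := fun P ↦ !![(2⁻¹ : ℂ) • (P + invert P), (2⁻¹ : ℂ) • (P - invert P);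
        (2⁻¹ : ℂ) • (P - invert P), (2⁻¹ : ℂ) • (P + invert P)]
      map_add' := fun P Q ↦ by
        ext1 i j
        fin_cases i <;> fin_cases j <;> simp [smul_eq_C_mul] <;> ring
      map_smul' := fun r P ↦ by
        ext1 i j
        fin_cases i <;> fin_cases j <;> simp [smul_eq_C_mul] <;> ring }
    (by
      have h := two_mul_C_inv_two
      ext1 i j
      fin_cases i <;> fin_cases j <;> simp [smul_eq_C_mul] <;> linear_combination h)
    (fun P Q ↦ by
      have h := two_mul_C_inv_two
      ext1 i j
      fin_cases i <;> fin_cases j <;>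
        simp [smul_eq_C_mul, Matrix.mul_apply, Fin.sum_univ_two]
      · linear_combination -C (2⁻¹ : ℂ) * (P * Q + invert P * invert Q) * h
      · linear_combination -C (2⁻¹ : ℂ) * (P * Q - invert P * invert Q) * h
      · linear_combination -C (2⁻¹ : ℂ) * (P * Q - invert P * invert Q) * h
      · linear_combination -C (2⁻¹ : ℂ) * (P * Q + invert P * invert Q) * h)

lemma circulantHom_apply (P : LaurentPolynomial ℂ) :
    circulantHom P = !![(2⁻¹ : ℂ) • (P + invert P), (2⁻¹ : ℂ) • (P - invert P);
      (2⁻¹ : ℂ) • (P - invert P), (2⁻¹ : ℂ) • (P + invert P)] := rfl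

lemma circulantHom_mem (P : LaurentPolynomial ℂ) : circulantHom P ∈ balancedSubalgebra := by
  have h : Function.Involutive (invert (R := ℂ)) := involutive_invert
  refine ⟨?_, ?_, ?_, ?_⟩ <;> simp [circulantHom_apply, smul_eq_C_mul, h P] <;> ring

/-- The homomorphism sending the generator of `ℤ/2ℤ` to `diag(1, -1)`. -/
noncomputable def diagSignHom :
    Multiplicative (ZMod 2) →* Matrix (Fin 2) (Fin 2) (LaurentPolynomial ℂ) where
  toFun g := !![1, 0; 0, (-1) ^ g.toAdd.val]
  map_one' := by simp [Matrix.one_fin_two]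
  map_mul' a b := by
    have h : (-1 : LaurentPolynomial ℂ) ^ 2 = 1 := by norm_num
    simp [toAdd_mul, ZMod.val_add, ← pow_eq_pow_mod _ h, pow_add]

lemma diagSignHom_one : diagSignHom (Multiplicative.ofAdd 1) = !![1, 0; 0, -1] := by
  simp [diagSignHom, ZMod.val_one]

lemma diagSignHom_mem (g : Multiplicative (ZMod 2)) : diagSignHom g ∈ balancedSubalgebra := by
  refine ⟨?_, ?_, ?_, ?_⟩ <;> simp [diagSignHom]

lemma multiplicative_zmod_two_cases (g : Multiplicative (ZMod 2)) :
    g = 1 ∨ g = Multiplicative.ofAdd 1 := by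
  revert g
  decide

lemma negAction_ofAdd_one (n : Multiplicative ℤ) :
    negAction (Multiplicative.ofAdd 1) n = n⁻¹ := by
  simp [negAction, negAut, ZMod.val_one]

lemma diagSignHom_mul_circulantHom_T (g : Multiplicative (ZMod 2)) (n : Multiplicative ℤ) :
    diagSignHom g * circulantHom (T n.toAdd) =
      circulantHom (T (negAction g n).toAdd) * diagSignHom g := by
  obtain rfl | rfl := multiplicative_zmod_two_cases g
  · simp
  · simp [negAction_ofAdd_one, diagSignHom_one, circulantHom_apply, ← smul_neg]
    simp [add_comm]

/-- The representation of `D∞` by matrices over the Laurent polynomials. -/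
noncomputable def dihedralRep : DInf →* Matrix (Fin 2) (Fin 2) (LaurentPolynomial ℂ) where
  toFun g := circulantHom (T g.left.toAdd) * diagSignHom g.right
  map_one' := by simp
  map_mul' a b := by
    simp only [SemidirectProduct.mul_left, SemidirectProduct.mul_right, toAdd_mul, T_add, map_mul]
    rw [mul_assoc, ← mul_assoc _ (diagSignHom _), ← diagSignHom_mul_circulantHom_T]
    simp only [mul_assoc]

/-- The inclusion `ℂ[t, t⁻¹] → ℂ[D∞]` induced by `ℤ → D∞`. -/
noncomputable def translationHom : LaurentPolynomial ℂ →ₐ[ℂ] MonoidAlgebra ℂ DInf :=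
  AddMonoidAlgebra.lift ℂ _ ℤ ((MonoidAlgebra.of ℂ DInf).comp SemidirectProduct.inl)

lemma translationHom_T (n : ℤ) : translationHom (T n) =
    MonoidAlgebra.of ℂ DInf (SemidirectProduct.inl (Multiplicative.ofAdd n)) := by
  rw [translationHom, T, AddMonoidAlgebra.lift_single, one_smul]
  rfl

/-- The algebra homomorphism `ℂ[D∞] → M₂(ℂ[t, t⁻¹])` extending `dihedralRep`. -/
noncomputable def dihedralAlgHom :
    MonoidAlgebra ℂ DInf →ₐ[ℂ] Matrix (Fin 2) (Fin 2) (LaurentPolynomial ℂ) :=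
  MonoidAlgebra.lift ℂ _ DInf dihedralRep

lemma dihedralAlgHom_of (g : DInf) : dihedralAlgHom (MonoidAlgebra.of ℂ DInf g) =
    circulantHom (T g.left.toAdd) * diagSignHom g.right :=
  MonoidAlgebra.lift_of dihedralRep g

lemma dihedralAlgHom_mem (x : MonoidAlgebra ℂ DInf) : dihedralAlgHom x ∈ balancedSubalgebra := by
  induction x using MonoidAlgebra.induction_on with
  | of g =>
    rw [dihedralAlgHom_of]
    exact mul_mem (circulantHom_mem _) (diagSignHom_mem _)
  | add x y hx hy => simpa using add_mem hx hy
  | smul r x hx => simpa using balancedSubalgebra.smul_mem hx r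

lemma dihedralAlgHom_translationHom (P : LaurentPolynomial ℂ) :
    dihedralAlgHom (translationHom P) = circulantHom P := by
  induction P using LaurentPolynomial.induction_on' with
  | add P Q hP hQ => simp [hP, hQ]
  | C_mul_T n r =>
    rw [← smul_eq_C_mul, map_smul, map_smul, map_smul, translationHom_T, dihedralAlgHom_of]
    simp

/-- The linear map `M₂(ℂ[t, t⁻¹]) → ℂ[D∞]` which is inverse to `dihedralAlgHom` on
`balancedSubalgebra`. -/
noncomputable def matrixToDihedral :
    Matrix (Fin 2) (Fin 2) (LaurentPolynomial ℂ) →ₗ[ℂ] MonoidAlgebra ℂ DInf where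
  toFun M := translationHom ((2⁻¹ : ℂ) • (M 0 0 + M 0 1 + M 1 0 + M 1 1)) +
    translationHom ((2⁻¹ : ℂ) • (M 0 0 - M 0 1 + M 1 0 - M 1 1)) *
      MonoidAlgebra.of ℂ DInf (SemidirectProduct.inr (Multiplicative.ofAdd 1))
  map_add' M N := by
    simp only [Matrix.add_apply, map_add, map_sub, map_smul, smul_add, smul_sub, add_mul, sub_mul]
    abel
  map_smul' r M := by
    simp only [RingHom.id_apply, smul_add, ← smul_mul_assoc, ← map_smul, Matrix.smul_apply,
      smul_sub, smul_comm r (2⁻¹ : ℂ)]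

lemma matrixToDihedral_apply (M : Matrix (Fin 2) (Fin 2) (LaurentPolynomial ℂ)) :
    matrixToDihedral M = translationHom ((2⁻¹ : ℂ) • (M 0 0 + M 0 1 + M 1 0 + M 1 1)) +
      translationHom ((2⁻¹ : ℂ) • (M 0 0 - M 0 1 + M 1 0 - M 1 1)) *
        MonoidAlgebra.of ℂ DInf (SemidirectProduct.inr (Multiplicative.ofAdd 1)) := rfl

lemma dihedralAlgHom_matrixToDihedral {M : Matrix (Fin 2) (Fin 2) (LaurentPolynomial ℂ)}
    (hM : M ∈ balancedSubalgebra) : dihedralAlgHom (matrixToDihedral M) = M := by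
  obtain ⟨h₀, h₁, h₂, h₃⟩ := hM
  have h := two_mul_C_inv_two
  rw [matrixToDihedral_apply, map_add, map_mul, dihedralAlgHom_translationHom,
    dihedralAlgHom_translationHom, dihedralAlgHom_of]
  simp only [SemidirectProduct.left_inr, SemidirectProduct.right_inr, toAdd_one, T_zero, map_one,
    one_mul, diagSignHom_one, circulantHom_apply, smul_eq_C_mul, map_mul, map_add, map_sub,
    invert_C, h₀, h₁, h₂, h₃]
  ext1 i j
  fin_cases i <;> fin_cases j <;> simp
  · linear_combination M 0 0 * (4 * C (2⁻¹ : ℂ) ^ 2 + 2 * C (2⁻¹ : ℂ) + 1) * h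
  · linear_combination M 0 1 * (4 * C (2⁻¹ : ℂ) ^ 2 + 2 * C (2⁻¹ : ℂ) + 1) * h
  · linear_combination M 1 0 * (4 * C (2⁻¹ : ℂ) ^ 2 + 2 * C (2⁻¹ : ℂ) + 1) * h
  · linear_combination M 1 1 * (4 * C (2⁻¹ : ℂ) ^ 2 + 2 * C (2⁻¹ : ℂ) + 1) * h

lemma matrixToDihedral_dihedralAlgHom (x : MonoidAlgebra ℂ DInf) :
    matrixToDihedral (dihedralAlgHom x) = x := by
  induction x using MonoidAlgebra.induction_on with
  | add x y hx hy => simp [hx, hy]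
  | smul r x hx => simp [hx]
  | of g =>
    obtain ⟨n, e⟩ := g
    have key : ∀ P : LaurentPolynomial ℂ, matrixToDihedral (circulantHom P * diagSignHom e) =
        translationHom P * MonoidAlgebra.of ℂ DInf (SemidirectProduct.inr e) := by
      intro P
      rw [matrixToDihedral_apply]
      obtain rfl | rfl := multiplicative_zmod_two_cases e
      · have h₁ : (2⁻¹ : ℂ) • ((2⁻¹ : ℂ) • (P + invert P) + (2⁻¹ : ℂ) • (P - invert P) +
            (2⁻¹ : ℂ) • (P - invert P) + (2⁻¹ : ℂ) • (P + invert P)) = P := by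
          module
        have h₂ : (2⁻¹ : ℂ) • ((2⁻¹ : ℂ) • (P + invert P) - (2⁻¹ : ℂ) • (P - invert P) +
            (2⁻¹ : ℂ) • (P - invert P) - (2⁻¹ : ℂ) • (P + invert P)) = 0 := by
          module
        simp only [map_one, mul_one, circulantHom_apply, Matrix.of_apply, Matrix.cons_val',
          Matrix.cons_val_zero, Matrix.cons_val_one, Matrix.cons_val_fin_one, h₁, h₂, map_zero,
          zero_mul, add_zero]
      · have hmul : circulantHom P * !![1, 0; 0, -1] =
            !![(2⁻¹ : ℂ) • (P + invert P), -((2⁻¹ : ℂ) • (P - invert P));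
              (2⁻¹ : ℂ) • (P - invert P), -((2⁻¹ : ℂ) • (P + invert P))] := by
          simp [circulantHom_apply, ← smul_neg]
        have h₁ : (2⁻¹ : ℂ) • ((2⁻¹ : ℂ) • (P + invert P) + -((2⁻¹ : ℂ) • (P - invert P)) +
            (2⁻¹ : ℂ) • (P - invert P) + -((2⁻¹ : ℂ) • (P + invert P))) = 0 := by
          module
        have h₂ : (2⁻¹ : ℂ) • ((2⁻¹ : ℂ) • (P + invert P) - -((2⁻¹ : ℂ) • (P - invert P)) +
            (2⁻¹ : ℂ) • (P - invert P) - -((2⁻¹ : ℂ) • (P + invert P))) = P := by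
          module
        simp only [diagSignHom_one, hmul, Matrix.of_apply, Matrix.cons_val', Matrix.cons_val_zero,
          Matrix.cons_val_one, Matrix.cons_val_fin_one, h₁, h₂, map_zero, zero_add]
    rw [dihedralAlgHom_of, key, translationHom_T, ← map_mul, ofAdd_toAdd,
      ← SemidirectProduct.mk_eq_inl_mul_inr]

/-- The isomorphism of `ℂ[D∞]` with the algebra of matrices with balanced diagonal and
anti-balanced off-diagonal entries. -/
noncomputable def dihedralEquiv : MonoidAlgebra ℂ DInf ≃ₐ[ℂ] balancedSubalgebra :=
  AlgEquiv.ofBijective (dihedralAlgHom.codRestrict balancedSubalgebra dihedralAlgHom_mem)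
    ⟨fun _ _ hxy ↦ Function.LeftInverse.injective matrixToDihedral_dihedralAlgHom
        (congrArg Subtype.val hxy),
      fun M ↦ ⟨matrixToDihedral M, Subtype.ext (dihedralAlgHom_matrixToDihedral M.2)⟩⟩

lemma coe_dihedralEquiv (x : MonoidAlgebra ℂ DInf) :
    (dihedralEquiv x : Matrix (Fin 2) (Fin 2) (LaurentPolynomial ℂ)) = dihedralAlgHom x := rfl

/-- The set `A` of `2×2` matrices over `𝕄 = ℂ[t,t⁻¹]` with
balanced diagonal entries and anti-balanced off-diagonal entries is a unital
`ℂ`-subalgebra of `M₂(𝕄)`, and there is an isomorphism of unital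
`ℂ`-algebras `ℂ[D∞] ≅ A` sending the generator of `ℤ` to the matrix with
diagonal entries `(t+t⁻¹)/2` and off-diagonal entries `(t−t⁻¹)/2`, and the
generator of `ℤ/2ℤ` to `diag(1,−1)`.  (Here `α = LaurentPolynomial.invert`
is the involution `t ↦ t⁻¹`; balanced means `α P = P`, anti-balanced means
`α P = -P`.) -/
theorem stmt5 :
    ∃ S : Subalgebra ℂ (Matrix (Fin 2) (Fin 2) (LaurentPolynomial ℂ)),
      (∀ M : Matrix (Fin 2) (Fin 2) (LaurentPolynomial ℂ),
        M ∈ S ↔ (invert (M 0 0) = M 0 0 ∧ invert (M 1 1) = M 1 1 ∧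
                 invert (M 0 1) = -(M 0 1) ∧ invert (M 1 0) = -(M 1 0))) ∧
      ∃ iso : MonoidAlgebra ℂ DInf ≃ₐ[ℂ] S,
        ((iso (MonoidAlgebra.of ℂ DInf
            (SemidirectProduct.inl (Multiplicative.ofAdd (1 : ℤ)))) : S) :
              Matrix (Fin 2) (Fin 2) (LaurentPolynomial ℂ)) =
          !![(2⁻¹ : ℂ) • (T 1 + T (-1)), (2⁻¹ : ℂ) • (T 1 - T (-1));
             (2⁻¹ : ℂ) • (T 1 - T (-1)), (2⁻¹ : ℂ) • (T 1 + T (-1))] ∧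
        ((iso (MonoidAlgebra.of ℂ DInf
            (SemidirectProduct.inr (Multiplicative.ofAdd (1 : ZMod 2)))) : S) :
              Matrix (Fin 2) (Fin 2) (LaurentPolynomial ℂ)) =
          !![1, 0; 0, -1] := by
  refine ⟨balancedSubalgebra, fun M ↦ Iff.rfl, dihedralEquiv, ?_, ?_⟩
  · rw [coe_dihedralEquiv, dihedralAlgHom_of]
    simp [circulantHom_apply]
  · rw [coe_dihedralEquiv, dihedralAlgHom_of]
    simp [diagSignHom_one]
end

section
/- Let n ≥ 1 and let γ ∈ Sₙ be a permutation whose cycle type (counting fixed points as cycles of length 1) has distinct part sizes μ₁ < … < μ_p, where μ_r occurs with multiplicity n_r. Let γ act on X = (ℂˣ)ⁿ by permuting coordinates, let X^γ be its fixed-point set, and let the centralizer Z(γ) of γ in Sₙ act on X^γ. Then the quotient X^γ/Z(γ) is in bijection with Sym^{n₁}(ℂˣ) × ⋯ × Sym^{n_p}(ℂˣ), the product of symmetric powers of ℂˣ. -/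
open Equiv Equiv.Perm

theorem exists_equiv_comp_eq_of_map_univ_eq {α β δ : Type*} [Fintype α] [Fintype β]
    {f : α → δ} {g : β → δ} (h : Finset.univ.val.map f = Finset.univ.val.map g) :
    ∃ e : α ≃ β, ∀ a, g (e a) = f a := by
  classical
  have hcard (c : δ) : Fintype.card {a // f a = c} = Fintype.card {b // g b = c} := by
    have hc := congrArg (Multiset.count c) h
    rw [Multiset.count_map, Multiset.count_map] at hc
    rw [Fintype.card_subtype, Fintype.card_subtype]
    simpa only [Finset.card, Finset.filter, eq_comm] using hc
  exact ⟨Equiv.ofFiberEquiv fun c => Fintype.equivOfCardEq (hcard c),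
    fun a => Equiv.ofFiberEquiv_map _ a⟩

theorem Sym.exists_map_univ_eq {A : Type*} {m : ℕ} (s : Sym A m) :
    ∃ f : Fin m → A, Finset.univ.val.map f = s.1 := by
  obtain ⟨s, hs⟩ := s
  induction s using Quotient.inductionOn with
  | h l =>
    have hl : l.length = m := by simpa using hs
    subst hl
    exact ⟨l.get, by simp⟩

/-- Families of multisets on the rows of a finite sigma type agree exactly when the underlying
functions differ by a permutation preserving the rows. -/
theorem forall_map_univ_eq_iff_exists_perm {ι A : Type*} {m : ι → ℕ}
    (f g : (Σ r, Fin (m r)) → A) :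
    (∀ r, Finset.univ.val.map (fun i => f ⟨r, i⟩) = Finset.univ.val.map (fun i => g ⟨r, i⟩)) ↔
      ∃ σ : Perm (Σ r, Fin (m r)), (∀ q, (σ q).1 = q.1) ∧ ∀ q, g (σ q) = f q := by
  constructor
  · intro h
    choose e he using fun r => exists_equiv_comp_eq_of_map_univ_eq (h r)
    exact ⟨Equiv.sigmaCongrRight e, fun _ => rfl, fun q => he q.1 q.2⟩
  · rintro ⟨σ, hσ, hfg⟩ r
    let τ : Perm (Fin (m r)) := (Equiv.sigmaSubtype r).symm.trans
      ((σ.subtypeEquiv fun q => by rw [hσ]).trans (Equiv.sigmaSubtype r))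
    have hτ (i : Fin (m r)) : (⟨r, τ i⟩ : Σ r, Fin (m r)) = σ ⟨r, i⟩ :=
      congrArg Subtype.val ((Equiv.sigmaSubtype r).symm_apply_apply
        (σ.subtypeEquiv (p := fun q => q.1 = r) (q := fun q => q.1 = r) (fun q => by rw [hσ])
          ((Equiv.sigmaSubtype r).symm i)))
    conv_rhs => rw [← Multiset.map_univ_val_equiv τ, Multiset.map_map]
    refine Multiset.map_congr rfl fun i _ => ?_
    simp only [Function.comp_apply, hτ, hfg]

namespace Equiv.Perm

variable {α : Type*}

/-- The set of cycles of a permutation, fixed points included. -/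
abbrev Orbits (γ : Perm α) : Type _ := Quotient (SameCycle.setoid γ)

theorem SameCycle.period_eq {γ : Perm α} {a b : α} (h : γ.SameCycle a b) :
    MulAction.period γ a = MulAction.period γ b := by
  obtain ⟨k, rfl⟩ := h
  refine Nat.dvd_right_iff_eq.mp fun n => ?_
  rw [← MulAction.pow_smul_eq_iff_period_dvd, ← MulAction.pow_smul_eq_iff_period_dvd,
    Perm.smul_def, Perm.smul_def, ← Perm.mul_apply, ← zpow_natCast, ← zpow_add, add_comm, zpow_add,
    Perm.mul_apply, (γ ^ k).injective.eq_iff]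

theorem period_apply_of_commute {γ z : Perm α} (h : Commute z γ) (a : α) :
    MulAction.period γ (z a) = MulAction.period γ a := by
  refine Nat.dvd_right_iff_eq.mp fun n => ?_
  rw [← MulAction.pow_smul_eq_iff_period_dvd, ← MulAction.pow_smul_eq_iff_period_dvd,
    Perm.smul_def, Perm.smul_def, ← Perm.mul_apply, ← (h.pow_right n).eq, Perm.mul_apply,
    z.injective.eq_iff]

/-- The length of a cycle. -/
noncomputable def Orbits.size {γ : Perm α} : γ.Orbits → ℕ :=
  Quotient.lift (MulAction.period γ) fun _ _ h => SameCycle.period_eq h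

@[simp] theorem Orbits.size_mk {γ : Perm α} (a : α) :
    Orbits.size (Quotient.mk (SameCycle.setoid γ) a) = MulAction.period γ a := rfl

theorem Orbits.period_out {γ : Perm α} (o : γ.Orbits) : MulAction.period γ o.out = o.size := by
  rw [← Orbits.size_mk, Quotient.out_eq]

theorem period_eq_one_iff {γ : Perm α} {a : α} : MulAction.period γ a = 1 ↔ γ a = a := by
  rw [← Nat.dvd_one, ← MulAction.pow_smul_eq_iff_period_dvd, pow_one, Perm.smul_def]

theorem period_eq_card_support_cycleOf [Fintype α] [DecidableEq α] {γ : Perm α} {a : α}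
    (h : γ a ≠ a) : MulAction.period γ a = (γ.cycleOf a).support.card := by
  have hc := isCycle_cycleOf γ h
  rw [← hc.orderOf]
  refine Nat.dvd_right_iff_eq.mp fun n => ?_
  rw [← MulAction.pow_smul_eq_iff_period_dvd, orderOf_dvd_iff_pow_eq_one,
    hc.pow_eq_one_iff' (x := a) (by simpa using h), cycleOf_pow_apply_self, Perm.smul_def]

theorem map_size_univ_orbits [Fintype α] [DecidableEq α] (γ : Perm α) [Fintype γ.Orbits]
    [Fintype {i // γ i = i}] :
    (Finset.univ : Finset γ.Orbits).val.map Orbits.size =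
      γ.cycleType + Multiset.replicate (Fintype.card {i // γ i = i}) 1 := by
  classical
  have hout (o : γ.Orbits) : γ o.out = o.out ↔ o.size = 1 := by
    rw [← period_eq_one_iff, Orbits.period_out]
  rw [← Multiset.filter_add_not (fun o => o.size ≠ 1) (Finset.univ : Finset γ.Orbits).val,
    Multiset.map_add]
  congr 1
  · rw [cycleType_def]
    refine Multiset.map_eq_map_of_bij_of_nodup _ _ (Finset.univ.nodup.filter _)
      γ.cycleFactorsFinset.nodup (fun o _ => γ.cycleOf o.out) ?_ ?_ ?_ ?_
    · intro o ho
      simp only [Multiset.mem_filter] at ho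
      rw [Finset.mem_val, cycleOf_mem_cycleFactorsFinset_iff, mem_support, Ne, hout]
      exact ho.2
    · intro o ho o' ho' h
      simp only [Multiset.mem_filter] at ho ho'
      rw [← Quotient.out_equiv_out]
      refine (sameCycle_iff_cycleOf_eq_of_mem_support ?_ ?_).mpr h
      · rw [mem_support, Ne, hout]
        exact ho.2
      · rw [mem_support, Ne, hout]
        exact ho'.2
    · intro c hc
      rw [Finset.mem_val] at hc
      obtain ⟨a, ha⟩ := (mem_cycleFactorsFinset_iff.mp hc).1.nonempty_support
      have hca := (cycle_is_cycleOf ha hc)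
      have ha' : γ a ≠ a := mem_support.mp (mem_cycleFactorsFinset_support_le hc ha)
      refine ⟨Quotient.mk _ a, ?_, ?_⟩
      · simpa [period_eq_one_iff] using ha'
      · rw [hca]
        exact SameCycle.cycleOf_eq (Quotient.mk_out (s := SameCycle.setoid γ) a)
    · intro o ho
      simp only [Multiset.mem_filter] at ho
      rw [← Orbits.period_out, Function.comp_apply, period_eq_card_support_cycleOf]
      rw [Ne, hout]
      exact ho.2
  · rw [← Finset.card_univ, Finset.card_def, ← Multiset.map_const']
    symm
    refine Multiset.map_eq_map_of_bij_of_nodup _ _ (Finset.univ.nodup)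
      (Finset.univ.nodup.filter _) (fun i _ => Quotient.mk _ i.1) ?_ ?_ ?_ ?_
    · rintro ⟨i, hi⟩ -
      simpa [period_eq_one_iff] using hi
    · rintro ⟨i, hi⟩ - ⟨j, hj⟩ - h
      obtain ⟨k, hk⟩ : γ.SameCycle i j := Quotient.exact h
      rw [zpow_apply_eq_self_of_apply_eq_self hi] at hk
      exact Subtype.ext hk
    · intro o ho
      simp only [Multiset.mem_filter, not_not] at ho
      exact ⟨⟨o.out, (hout o).mpr ho.2⟩, Finset.mem_univ _, Quotient.out_eq o⟩
    · rintro ⟨i, hi⟩ -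
      exact (period_eq_one_iff.mpr hi).symm

/-- A permutation of the cycles preserving lengths is induced by an element of the centralizer. -/
theorem exists_commute_mk_apply_eq [Finite α] {γ : Perm α} (σ : Perm γ.Orbits)
    (hσ : ∀ o, (σ o).size = o.size) :
    ∃ z : Perm α, Commute z γ ∧
      ∀ a, (Quotient.mk _ (z a) : γ.Orbits) = σ (Quotient.mk _ a) := by
  choose k hk using fun a : α => Quotient.mk_out (s := SameCycle.setoid γ) a
  have hzpow (o : γ.Orbits) (i j : ℤ) :
      (γ ^ i) (σ o).out = (γ ^ j) (σ o).out ↔ (γ ^ i) o.out = (γ ^ j) o.out := by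
    have key (b : α) : (γ ^ i) b = (γ ^ j) b ↔ (MulAction.period γ b : ℤ) ∣ i - j := by
      rw [← MulAction.zpow_smul_eq_iff_period_dvd, sub_eq_neg_add, zpow_add, Perm.smul_def,
        Perm.mul_apply, zpow_neg, Perm.inv_eq_iff_eq, eq_comm, eq_comm]
    rw [key, key, Orbits.period_out, Orbits.period_out, hσ]
  let z (a : α) : α := (γ ^ k a) (σ (Quotient.mk _ a)).out
  have hmk (a : α) : (Quotient.mk _ (z a) : γ.Orbits) = σ (Quotient.mk _ a) := by
    conv_rhs => rw [← Quotient.out_eq (σ (Quotient.mk _ a))]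
    exact Quotient.sound (s := SameCycle.setoid γ) (SameCycle.rfl.zpow_left)
  have hinj : Function.Injective z := by
    intro a b hab
    have ho : (Quotient.mk _ a : γ.Orbits) = Quotient.mk _ b := by
      apply σ.injective
      rw [← hmk, ← hmk, hab]
    simp only [z, ho] at hab
    rw [hzpow] at hab
    rw [← hk a, ← hk b, ho, hab]
  refine ⟨Equiv.ofBijective z (Finite.injective_iff_bijective.mp hinj), ?_, hmk⟩
  ext a
  have ho : (Quotient.mk _ (γ a) : γ.Orbits) = Quotient.mk _ a :=
    Quotient.sound (s := SameCycle.setoid γ) (sameCycle_apply_left.mpr SameCycle.rfl)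
  change z (γ a) = γ (z a)
  have h : (γ ^ k (γ a)) (Quotient.mk (SameCycle.setoid γ) a).out =
      (γ ^ (1 + k a)) (Quotient.mk (SameCycle.setoid γ) a).out := by
    rw [zpow_add, zpow_one, Perm.mul_apply, hk a, ← ho, hk]
  rw [← hzpow, zpow_add, zpow_one, Perm.mul_apply] at h
  simpa only [z, ho] using h

theorem exists_perm_orbits_of_commute {γ z : Perm α} (hz : Commute z γ) :
    ∃ σ : Perm γ.Orbits, (∀ o, (σ o).size = o.size) ∧
      ∀ a, σ (Quotient.mk _ a) = Quotient.mk _ (z a) := by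
  refine ⟨Quotient.congr z fun a b => ?_, ?_, fun _ => rfl⟩
  · refine exists_congr fun k => ?_
    rw [← Perm.mul_apply, ← (hz.zpow_right k).eq, Perm.mul_apply, z.injective.eq_iff]
  · rintro ⟨a⟩
    exact period_apply_of_commute hz a

/-- The functions fixed by `γ` are the functions on its set of cycles. -/
def fixedFunctionsEquiv (γ : Perm α) (A : Type*) :
    {x : α → A // ∀ i, x (γ i) = x i} ≃ (γ.Orbits → A) where
  toFun x := Quotient.lift x.1 <| by
    have hpow (k : ℕ) (b : α) : x.1 ((γ ^ k) b) = x.1 b := by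
      induction k with
      | zero => rfl
      | succ k ih => rw [pow_succ', Perm.mul_apply, x.2, ih]
    rintro a _ ⟨k, rfl⟩
    obtain ⟨k, rfl | rfl⟩ := k.eq_nat_or_neg
    · rw [zpow_natCast, hpow]
    · rw [← hpow k ((γ ^ (-(k : ℤ))) a), zpow_neg, zpow_natCast, ← Perm.mul_apply, mul_inv_cancel, Perm.one_apply]
  invFun f := ⟨fun a => f (Quotient.mk _ a), fun a => congrArg f <|
    Quotient.sound (s := SameCycle.setoid γ) (sameCycle_apply_left.mpr SameCycle.rfl)⟩
  left_inv _ := rfl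
  right_inv f := by
    ext ⟨a⟩
    rfl

theorem exists_mem_centralizer_iff [Finite α] {γ : Perm α} {A : Type*}
    (x y : {x : α → A // ∀ i, x (γ i) = x i}) :
    (∃ z ∈ Subgroup.centralizer ({γ} : Set (Perm α)), ∀ i, y.1 i = x.1 (z⁻¹ i)) ↔
      ∃ σ : Perm γ.Orbits, (∀ o, (σ o).size = o.size) ∧
        ∀ o, fixedFunctionsEquiv γ A y (σ o) = fixedFunctionsEquiv γ A x o := by
  constructor
  · rintro ⟨z, hz, h⟩
    obtain ⟨σ, hσ, hmk⟩ := exists_perm_orbits_of_commute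
      (show Commute z γ from (Subgroup.mem_centralizer_singleton_iff.mp hz))
    refine ⟨σ, hσ, ?_⟩
    rintro ⟨a⟩
    change fixedFunctionsEquiv γ A y (σ (Quotient.mk _ a)) = x.1 a
    rw [hmk]
    change y.1 (z a) = x.1 a
    rw [h, ← Perm.mul_apply, inv_mul_cancel, Perm.one_apply]
  · rintro ⟨σ, hσ, h⟩
    obtain ⟨z, hz, hmk⟩ := exists_commute_mk_apply_eq σ hσ
    refine ⟨z, Subgroup.mem_centralizer_singleton_iff.mpr hz, fun i => ?_⟩
    have hi := h (Quotient.mk _ (z⁻¹ i))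
    rw [← hmk, ← Perm.mul_apply, mul_inv_cancel, Perm.one_apply] at hi
    exact hi

/-- For a permutation with `mult r` cycles of length `μ r`, the functions fixed by it modulo its
centralizer are the families of multisets of values on the cycles of each length. -/
theorem nonempty_quot_fixedFunctions_equiv [Fintype α] [DecidableEq α] {ι : Type*} [Fintype ι]
    (γ : Perm α) [Fintype {i // γ i = i}] (A : Type*) (μ mult : ι → ℕ)
    (hμ : Function.Injective μ)
    (hcycle : γ.cycleType + Multiset.replicate (Fintype.card {i // γ i = i}) 1 =
      ∑ r, Multiset.replicate (mult r) (μ r)) :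
    Nonempty
      (Quot (fun x y : {x : α → A // ∀ i, x (γ i) = x i} =>
          ∃ z ∈ Subgroup.centralizer ({γ} : Set (Perm α)), ∀ i, y.1 i = x.1 (z⁻¹ i)) ≃
        ((r : ι) → Sym A (mult r))) := by
  classical
  have hsigma : (Finset.univ : Finset (Σ r, Fin (mult r))).val.map (fun q => μ q.1) =
      ∑ r, Multiset.replicate (mult r) (μ r) := by
    ext k
    rw [Multiset.count_sum', Multiset.count_map, ← Finset.filter_val, ← Finset.card_def,
      Finset.card_filter, Fintype.sum_sigma]
    refine Finset.sum_congr rfl fun r _ => ?_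
    change ∑ _y : Fin (mult r), (if k = μ r then 1 else 0) = _
    rw [Multiset.count_replicate, Finset.sum_const, Finset.card_univ, Fintype.card_fin, smul_eq_mul,
      mul_ite, mul_one, mul_zero]
    simp only [eq_comm]
  obtain ⟨e, he⟩ := exists_equiv_comp_eq_of_map_univ_eq
    ((map_size_univ_orbits γ).trans (hcycle.trans hsigma.symm))
  let Φ (x : {x : α → A // ∀ i, x (γ i) = x i}) (r : ι) : Sym A (mult r) :=
    ⟨Finset.univ.val.map fun i => fixedFunctionsEquiv γ A x (e.symm ⟨r, i⟩),
      (Multiset.card_map _ _).trans (Fintype.card_fin _)⟩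
  have hΦ (x y : {x : α → A // ∀ i, x (γ i) = x i}) : Φ x = Φ y ↔
      ∃ z ∈ Subgroup.centralizer ({γ} : Set (Perm α)), ∀ i, y.1 i = x.1 (z⁻¹ i) := by
    have hval : Φ x = Φ y ↔ ∀ r,
        Finset.univ.val.map (fun i => fixedFunctionsEquiv γ A x (e.symm ⟨r, i⟩)) =
          Finset.univ.val.map (fun i => fixedFunctionsEquiv γ A y (e.symm ⟨r, i⟩)) :=
      funext_iff.trans (forall_congr' fun _ => Subtype.ext_iff)
    rw [exists_mem_centralizer_iff, hval,
      forall_map_univ_eq_iff_exists_perm (fun q => fixedFunctionsEquiv γ A x (e.symm q))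
      (fun q => fixedFunctionsEquiv γ A y (e.symm q)), ← e.permCongr.exists_congr_right]
    refine exists_congr fun σ => and_congr ?_ ?_
    · simp only [← e.forall_congr_right, permCongr_apply, symm_apply_apply, ← he, hμ.eq_iff]
    · simp only [← e.forall_congr_right, permCongr_apply, symm_apply_apply]
  refine ⟨Equiv.ofBijective (Quot.lift Φ fun x y h => (hΦ x y).mpr h) ⟨?_, ?_⟩⟩
  · rintro ⟨x⟩ ⟨y⟩ h
    exact Quot.sound ((hΦ x y).mp h)
  · intro s
    choose f hf using fun r => (s r).exists_map_univ_eq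
    refine ⟨Quot.mk _ ((fixedFunctionsEquiv γ A).symm fun o => f (e o).1 (e o).2), ?_⟩
    ext1 r
    apply Subtype.ext
    rw [← hf r]
    change Finset.univ.val.map (fun i => fixedFunctionsEquiv γ A
      ((fixedFunctionsEquiv γ A).symm fun o => f (e o).1 (e o).2) (e.symm ⟨r, i⟩)) = _
    refine Multiset.map_congr rfl fun i _ => ?_
    rw [apply_symm_apply, apply_symm_apply]

end Equiv.Perm

/-- Let `γ ∈ Sₙ` have cycle type (counting fixed points as
cycles of length 1) with distinct part sizes `μ₁ < … < μ_p`, `μ_r` occurring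
with multiplicity `n_r` (`mult r` below).  Let `γ` act on `X = (ℂˣ)ⁿ` by
permuting coordinates, let `X^γ` be its fixed-point set, acted on by the
centralizer `Z(γ)` of `γ` in `Sₙ`.  Then `X^γ/Z(γ)` is in bijection with
`Sym^{n₁}(ℂˣ) × ⋯ × Sym^{n_p}(ℂˣ)`. -/
theorem stmt10 (n p : ℕ) (hn : 1 ≤ n) (γ : Equiv.Perm (Fin n))
    (μ mult : Fin p → ℕ) (hμ : StrictMono μ) (hμpos : ∀ r, 1 ≤ μ r)
    (hmult : ∀ r, 1 ≤ mult r)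
    (hcycle : γ.cycleType +
        Multiset.replicate (Fintype.card {i : Fin n // γ i = i}) 1 =
      ∑ r : Fin p, Multiset.replicate (mult r) (μ r)) :
    Nonempty
      (Quot (fun x y : {x : Fin n → ℂˣ // ∀ i, x (γ i) = x i} =>
          ∃ z ∈ Subgroup.centralizer ({γ} : Set (Equiv.Perm (Fin n))),
            ∀ i, (y : Fin n → ℂˣ) i = (x : Fin n → ℂˣ) (z⁻¹ i)) ≃
        ((r : Fin p) → Sym ℂˣ (mult r))) := by
  exact Equiv.Perm.nonempty_quot_fixedFunctions_equiv γ ℂˣ μ mult hμ.injective hcycle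
end

section
/- Let n ≥ 1 and let the symmetric group Sₙ act on X = (ℂˣ)ⁿ by permuting coordinates. Then the extended quotient X̃/Sₙ is in bijection with the disjoint union, over all partitions μ of n, of the products Sym^{n₁(μ)}(ℂˣ) × ⋯ × Sym^{n_p(μ)}(ℂˣ), where μ₁ < … < μ_p are the distinct part sizes of μ and n_r(μ) is the multiplicity of μ_r in μ. -/
open Function

theorem exists_equiv_of_map_univ_eq {ι κ β : Type*} [Fintype ι] [Fintype κ] {f : ι → β} {g : κ → β}
    (h : Finset.univ.val.map f = Finset.univ.val.map g) : ∃ e : ι ≃ κ, g ∘ e = f := by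
  classical
  have hcard (b : β) : Fintype.card {i // f i = b} = Fintype.card {k // g k = b} := by
    have := congrArg (Multiset.count b) h
    rw [Multiset.count_map, Multiset.count_map] at this
    simp only [Fintype.card_subtype, Finset.card_def, Finset.filter_val]
    simpa only [eq_comm] using this
  refine ⟨(Equiv.sigmaFiberEquiv f).symm.trans ((Equiv.sigmaCongrRight fun b =>
    Fintype.equivOfCardEq (hcard b)).trans (Equiv.sigmaFiberEquiv g)), funext fun i => ?_⟩
  exact ((Fintype.equivOfCardEq (hcard (f i))) ⟨i, rfl⟩).2

/-- The cyclic successor on `Fin k`. -/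
def Fin.cyclicSucc {k : ℕ} (j : Fin k) : Fin k :=
  ⟨(j + 1) % k, Nat.mod_lt _ j.pos⟩

theorem Fin.cyclicSucc_injective {k : ℕ} : Injective (Fin.cyclicSucc (k := k)) := by
  intro a b h
  have h' : (a : ℕ) + 1 ≡ b + 1 [MOD k] := congrArg Fin.val h
  exact Fin.ext ((Nat.ModEq.add_right_cancel' 1 h').eq_of_lt_of_lt a.2 b.2)

theorem Fin.cyclicSucc_iterate_val {k : ℕ} (t : ℕ) (j : Fin k) :
    (Fin.cyclicSucc^[t] j : ℕ) = (j + t) % k := by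
  induction t with
  | zero => simp [Nat.mod_eq_of_lt j.2]
  | succ t ih =>
    rw [iterate_succ_apply', Fin.cyclicSucc]
    simp only [ih, Nat.mod_add_mod]
    rw [add_assoc]

theorem Fin.minimalPeriod_cyclicSucc {k : ℕ} (j : Fin k) :
    minimalPeriod Fin.cyclicSucc j = k := by
  refine Nat.dvd_right_iff_eq.mp fun t => ?_
  rw [← isPeriodicPt_iff_minimalPeriod_dvd, IsPeriodicPt, IsFixedPt, Fin.ext_iff,
    Fin.cyclicSucc_iterate_val]
  conv_lhs => rhs; rw [← Nat.mod_eq_of_lt j.2]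
  change (j : ℕ) + t ≡ j + 0 [MOD k] ↔ _
  rw [Nat.ModEq.add_iff_left rfl, Nat.modEq_zero_iff_dvd]

universe u

/-- `HasCycleData σ x m` says that `m` is the multiset of pairs (length of `c`, value of `x` on `c`)
where `c` runs over the cycles of `σ`, fixed points included, and that `x` is constant
on each of these cycles. -/
def HasCycleData {α X : Type u} (σ : Equiv.Perm α) (x : α → X) (m : Multiset (ℕ × X)) : Prop :=
  ∃ (ι : Type u) (_ : Fintype ι) (f : ι → ℕ × X) (e : (Σ i, Fin (f i).1) ≃ α),
    Finset.univ.val.map f = m ∧ (∀ i, 0 < (f i).1) ∧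
      ∀ i j, σ (e ⟨i, j⟩) = e ⟨i, j.cyclicSucc⟩ ∧ x (e ⟨i, j⟩) = (f i).2

namespace HasCycleData

variable {α β X : Type u} {σ : Equiv.Perm α} {x : α → X} {m m' : Multiset (ℕ × X)}

theorem pos (h : HasCycleData σ x m) : ∀ y ∈ m, 0 < y.1 := by
  obtain ⟨ι, _, f, e, rfl, hf, -⟩ := h
  simpa using hf

theorem sum_eq [Fintype α] (h : HasCycleData σ x m) : (m.map Prod.fst).sum = Fintype.card α := by
  obtain ⟨ι, _, f, e, rfl, -, -⟩ := h
  rw [← Fintype.card_congr e, Fintype.card_sigma]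
  simp

theorem congr (h : HasCycleData σ x m) (g : α ≃ β) {τ : Equiv.Perm β} {y : β → X}
    (hτ : ∀ a, τ (g a) = g (σ a)) (hy : ∀ a, y (g a) = x a) : HasCycleData τ y m := by
  obtain ⟨ι, _, f, e, hm, hf, he⟩ := h
  refine ⟨ι, _, f, e.trans g, hm, hf, fun i j => ?_⟩
  simp [hτ, hy, he]

theorem exists_equiv (h : HasCycleData σ x m) {τ : Equiv.Perm β} {y : β → X}
    (h' : HasCycleData τ y m) :
    ∃ g : α ≃ β, (∀ a, τ (g a) = g (σ a)) ∧ ∀ a, y (g a) = x a := by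
  obtain ⟨ι, _, f, e, hm, -, he⟩ := h
  obtain ⟨κ, _, f', e', hm', -, he'⟩ := h'
  obtain ⟨u, rfl⟩ := exists_equiv_of_map_univ_eq (hm.trans hm'.symm)
  let v : (Σ i, Fin (f' (u i)).1) ≃ Σ k, Fin (f' k).1 :=
    u.sigmaCongrLeft (β := fun k => Fin (f' k).1)
  have hv (i j) : v ⟨i, j⟩ = ⟨u i, j⟩ := rfl
  refine ⟨e.symm.trans (v.trans e'), fun a => ?_, fun a => ?_⟩ <;>
  · obtain ⟨⟨i, j⟩, rfl⟩ := e.surjective a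
    have h₁ := he i j
    have h₂ := he' (u i) j
    simp only [Equiv.trans_apply, Equiv.symm_apply_apply, hv, h₁, h₂, comp_apply]

theorem map_minimalPeriod [Fintype α] (h : HasCycleData σ x m) :
    Finset.univ.val.map (fun a => (minimalPeriod σ a, x a)) =
      m.bind fun y => Multiset.replicate y.1 y := by
  obtain ⟨ι, _, f, e, rfl, -, he⟩ := h
  have hper (i) (j : Fin (f i).1) : minimalPeriod σ (e ⟨i, j⟩) = (f i).1 := by
    have hsemi : Semiconj (fun j => e ⟨i, j⟩) Fin.cyclicSucc σ := fun j => ((he i j).1).symm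
    rw [← Fin.minimalPeriod_cyclicSucc j]
    refine Nat.dvd_right_iff_eq.mp fun t => ?_
    rw [← isPeriodicPt_iff_minimalPeriod_dvd, ← isPeriodicPt_iff_minimalPeriod_dvd]
    refine ⟨fun ht => ?_, fun ht => ht.map hsemi⟩
    have := (hsemi.iterate_right t j).trans ht
    exact eq_of_heq (Sigma.mk.inj (e.injective this)).2
  have hval (s : Σ i, Fin (f i).1) : (minimalPeriod σ (e s), x (e s)) = f s.1 :=
    Prod.ext (hper s.1 s.2) (he s.1 s.2).2
  rw [← Multiset.map_univ_val_equiv e, Multiset.map_map, Multiset.bind_map]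
  simp only [comp_def, hval]
  change (Multiset.map (fun s : Σ i, Fin (f i).1 => f s.1)
    (Multiset.sigma Finset.univ.val fun i => (Finset.univ : Finset (Fin (f i).1)).val)) = _
  rw [Multiset.sigma, Multiset.map_bind]
  refine Multiset.bind_congr fun i _ => ?_
  rw [Multiset.map_map]
  simp only [comp_def, Multiset.map_const', Finset.card_val, Finset.card_univ, Fintype.card_fin]

theorem unique [Finite α] (h : HasCycleData σ x m) (h' : HasCycleData σ x m') : m = m' := by
  classical
  have := Fintype.ofFinite α
  have hcount (m : Multiset (ℕ × X)) (y : ℕ × X) :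
      (m.bind fun y => Multiset.replicate y.1 y).count y = y.1 * m.count y := by
    induction m using Multiset.induction_on with
    | empty => simp
    | cons z m ih =>
      rw [Multiset.cons_bind, Multiset.count_add, ih, Multiset.count_replicate,
        Multiset.count_cons, mul_add, add_comm]
      by_cases hz : z = y
      · simp [hz]
      · simp [hz, Ne.symm hz]
  ext y
  by_cases hy : 0 < y.1
  · refine Nat.eq_of_mul_eq_mul_left hy ?_
    rw [← hcount, ← hcount, ← h.map_minimalPeriod, ← h'.map_minimalPeriod]
  · rw [Multiset.count_eq_zero_of_notMem fun hm => hy (h.pos y hm),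
      Multiset.count_eq_zero_of_notMem fun hm => hy (h'.pos y hm)]

theorem exists_of_invariant [Finite α] (σ : Equiv.Perm α) (x : α → X) (hx : ∀ a, x (σ a) = x a) :
    ∃ m, HasCycleData σ x m := by
  classical
  have := Fintype.ofFinite α
  let s := Equiv.Perm.SameCycle.setoid σ
  have hper (a : α) : 0 < minimalPeriod σ a :=
    minimalPeriod_pos_of_mem_periodicPts (σ.injective.mem_periodicPts a)
  have hiter (t : ℕ) (a : α) : x (σ^[t] a) = x a := by
    induction t with
    | zero => rfl
    | succ t ih => rw [iterate_succ_apply', hx, ih]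
  have hsame (t : ℕ) (a : α) : σ.SameCycle a (σ^[t] a) := ⟨t, by simp [← Equiv.Perm.iterate_eq_pow]⟩
  let f : Quotient s → ℕ × X := fun o => (minimalPeriod σ o.out, x o.out)
  let e : (Σ o, Fin (f o).1) → α := fun p => σ^[p.2] p.1.out
  have he : Bijective e := by
    constructor
    · rintro ⟨o, i⟩ ⟨o', j⟩ h
      have ho : o = o' := by
        rw [← o.out_eq, ← o'.out_eq]
        have hi := hsame i o.out
        rw [show σ^[i] o.out = σ^[j] o'.out from h] at hi
        exact Quotient.sound (hi.trans (hsame j o'.out).symm)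
      subst ho
      rw [Fin.ext ((iterate_eq_iterate_iff_of_lt_minimalPeriod i.2 j.2).mp h)]
    · intro a
      obtain ⟨t, ht⟩ := (show σ.SameCycle (⟦a⟧ : Quotient s).out a from
        Quotient.mk_out a).exists_nat_pow_eq
      refine ⟨⟨⟦a⟧, ⟨t % _, Nat.mod_lt _ (hper _)⟩⟩, ?_⟩
      simp only [e, f, iterate_mod_minimalPeriod_eq]
      rwa [Equiv.Perm.iterate_eq_pow]
  refine ⟨_, Quotient s, inferInstance, f, Equiv.ofBijective e he, rfl, fun o => hper _,
    fun o j => ⟨?_, hiter _ _⟩⟩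
  change σ (σ^[j] o.out) = σ^[(j + 1) % minimalPeriod σ o.out] o.out
  rw [iterate_mod_minimalPeriod_eq, iterate_succ_apply']

theorem exists_of_sum_eq [Fintype α] (hpos : ∀ y ∈ m, 0 < y.1)
    (hsum : (m.map Prod.fst).sum = Fintype.card α) :
    ∃ (σ : Equiv.Perm α) (x : α → X), (∀ a, x (σ a) = x a) ∧ HasCycleData σ x m := by
  classical
  let f : m.ToType → ℕ × X := fun i => i.1
  have hm : Finset.univ.val.map f = m := m.map_univ_coe
  have hcard : Fintype.card (Σ i, Fin (f i).1) = Fintype.card α := by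
    rw [← hsum, Fintype.card_sigma]
    conv_rhs => rw [← hm]
    simp
  let e := Fintype.equivOfCardEq hcard
  let c : Equiv.Perm (Σ i, Fin (f i).1) := Equiv.sigmaCongrRight fun i =>
    Equiv.ofBijective _ (Finite.injective_iff_bijective.mp Fin.cyclicSucc_injective)
  have hc (i j) : c ⟨i, j⟩ = ⟨i, j.cyclicSucc⟩ := rfl
  refine ⟨e.permCongr c, fun a => (f (e.symm a).1).2, fun a => ?_,
    m.ToType, inferInstance, f, e, hm, fun i => hpos _ (Multiset.coe_mem), fun i j => ?_⟩
  · simp [Equiv.permCongr_apply, c]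
  · simp [Equiv.permCongr_apply, hc]

end HasCycleData

/-- The multisets of pairs `(k, a)` with `k` positive and the `k` summing to `n`. -/
abbrev ColoredPartition (n : ℕ) (X : Type*) :=
  {m : Multiset (ℕ × X) // (∀ y ∈ m, 0 < y.1) ∧ (m.map Prod.fst).sum = n}

namespace ColoredPartition

variable {n : ℕ} {X : Type*}

/-- Forgetting the colors of a colored partition, and recording for each part size
the multiset of its colors. -/
def toSigma (m : ColoredPartition n X) :
    Σ μ : Nat.Partition n, ((a : {a : ℕ // a ∈ μ.parts.toFinset}) →
      Sym X (Multiset.count a.1 μ.parts)) :=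
  ⟨⟨m.1.map Prod.fst, by
      intro i hi
      obtain ⟨y, hy, rfl⟩ := Multiset.mem_map.mp hi
      exact m.2.1 y hy, m.2.2⟩,
    fun a => ⟨(m.1.filter fun y => a.1 = y.1).map Prod.snd, by
      rw [Multiset.card_map, Multiset.count_map]⟩⟩

theorem sigma_sym_ext
    {t t' : Σ μ : Nat.Partition n, ((a : {a : ℕ // a ∈ μ.parts.toFinset}) →
      Sym X (Multiset.count a.1 μ.parts))}
    (h : t.1.parts = t'.1.parts)
    (hs : ∀ a ha ha', (t.2 ⟨a, ha⟩ : Multiset X) = t'.2 ⟨a, ha'⟩) : t = t' := by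
  obtain ⟨μ, s⟩ := t
  obtain ⟨μ', s'⟩ := t'
  obtain rfl : μ = μ' := Nat.Partition.ext h
  congr
  funext a
  exact Subtype.ext (hs a.1 a.2 a.2)

theorem toSigma_injective : Injective (toSigma (n := n) (X := X)) := by
  classical
  intro m m' h
  have hcolor (m : ColoredPartition n X) (k : ℕ) :
      (m.1.filter fun y => k = y.1).map Prod.snd =
        if hk : k ∈ (toSigma m).1.parts.toFinset then ((toSigma m).2 ⟨k, hk⟩ : Multiset X)
        else 0 := by
    split_ifs with hk
    · rfl
    · simp only [toSigma, Multiset.mem_toFinset, Multiset.mem_map, not_exists, not_and] at hk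
      rw [Multiset.map_eq_zero, Multiset.filter_eq_nil]
      exact fun y hy hky => hk y hy hky.symm
  have hcount (m : Multiset (ℕ × X)) (k : ℕ) (a : X) :
      m.count (k, a) = ((m.filter fun y => k = y.1).map Prod.snd).count a := by
    rw [Multiset.count_map, Multiset.filter_filter, Multiset.count, Multiset.countP_eq_card_filter]
    congr 2
    funext y
    simp [Prod.ext_iff, and_comm]
  refine Subtype.ext (Multiset.ext.mpr ?_)
  rintro ⟨k, a⟩
  rw [hcount, hcount, hcolor, hcolor, h]

theorem toSigma_surjective : Surjective (toSigma (n := n) (X := X)) := by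
  classical
  rintro ⟨μ, s⟩
  let m : Multiset (ℕ × X) := (Finset.univ : Finset {a // a ∈ μ.parts.toFinset}).val.bind
    fun a => (s a : Multiset X).map (Prod.mk a.1)
  have hfst : m.map Prod.fst = μ.parts := by
    simp only [m, Multiset.map_bind, Multiset.map_map, comp_def, Multiset.map_const', Sym.card_coe]
    ext k
    simp only [Multiset.count_bind, Multiset.count_replicate]
    change ∑ a : {a // a ∈ μ.parts.toFinset}, _ = _
    by_cases hk : k ∈ μ.parts.toFinset
    · rw [Finset.sum_eq_single ⟨k, hk⟩] <;> aesop
    · rw [Finset.sum_eq_zero, Multiset.count_eq_zero_of_notMem (by simpa using hk)]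
      aesop
  have hsnd (a) : (m.filter fun y => a.1 = y.1).map Prod.snd = (s a : Multiset X) := by
    simp only [m, Multiset.filter_bind, Multiset.map_bind, Multiset.filter_map, Multiset.map_map,
      comp_def, Multiset.map_id']
    change ∑ b : {a // a ∈ μ.parts.toFinset}, _ = _
    rw [Finset.sum_eq_single a]
    · simp
    · intro b _ hb
      have : a.1 ≠ b.1 := fun h => hb (Subtype.ext h.symm)
      simp [this]
    · simp
  refine ⟨⟨m, fun y hy => μ.parts_pos (hfst ▸ Multiset.mem_map_of_mem _ hy),
    hfst ▸ μ.parts_sum⟩, sigma_sym_ext hfst fun a _ ha' => hsnd ⟨a, ha'⟩⟩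

end ColoredPartition


/-- Let the symmetric group `Sₙ` act on `X = (ℂˣ)ⁿ` by
permuting coordinates.  Then the extended quotient `X̃/Sₙ` — the quotient of
`X̃ = {(γ,x) : γ x = x}` by the action `g • (γ,x) = (gγg⁻¹, g x)` — is in
bijection with the disjoint union, over all partitions `μ` of `n`, of the
products `Sym^{n₁(μ)}(ℂˣ) × ⋯ × Sym^{n_p(μ)}(ℂˣ)`, where the product is
over the distinct part sizes of `μ` and `n_r(μ)` is the multiplicity of the
`r`-th distinct part size in `μ`. -/
theorem stmt15 (n : ℕ) (hn : 1 ≤ n) :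
    Nonempty
      ((Quot (fun p q : {p : Equiv.Perm (Fin n) × (Fin n → ℂˣ) //
            ∀ i, p.2 (p.1 i) = p.2 i} =>
          ∃ g : Equiv.Perm (Fin n),
            (q : Equiv.Perm (Fin n) × (Fin n → ℂˣ)).1 =
              g * (p : Equiv.Perm (Fin n) × (Fin n → ℂˣ)).1 * g⁻¹ ∧
            ∀ i, (q : Equiv.Perm (Fin n) × (Fin n → ℂˣ)).2 i =
              (p : Equiv.Perm (Fin n) × (Fin n → ℂˣ)).2 (g⁻¹ i))) ≃
        (Σ μ : Nat.Partition n,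
          ((a : {a : ℕ // a ∈ μ.parts.toFinset}) →
            Sym ℂˣ (Multiset.count a.1 μ.parts)))) := by
  have hquot (p : {p : Equiv.Perm (Fin n) × (Fin n → ℂˣ) // ∀ i, p.2 (p.1 i) = p.2 i}) :
      ∃ m, HasCycleData p.1.1 p.1.2 m := HasCycleData.exists_of_invariant _ _ p.2
  choose M hM using hquot
  let F : {p : Equiv.Perm (Fin n) × (Fin n → ℂˣ) // ∀ i, p.2 (p.1 i) = p.2 i} →
      ColoredPartition n ℂˣ := fun p => ⟨M p, (hM p).pos, by simpa using (hM p).sum_eq⟩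
  refine ⟨(Equiv.ofBijective (Quot.lift F ?_) ⟨?_, ?_⟩).trans (Equiv.ofBijective _
    ⟨ColoredPartition.toSigma_injective, ColoredPartition.toSigma_surjective⟩)⟩
  · rintro p q ⟨g, hg, hgx⟩
    refine Subtype.ext (((hM p).congr g (fun a => ?_) fun a => ?_).unique (hM q))
    · simp [hg]
    · simp [hgx]
  · rintro ⟨p⟩ ⟨q⟩ h
    have hpq : M p = M q := congrArg Subtype.val h
    obtain ⟨g, hg, hgx⟩ := (hM p).exists_equiv (hpq ▸ hM q)
    refine Quot.sound ⟨g, Equiv.ext fun i => ?_, fun i => ?_⟩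
    · simp [← hg]
    · simp [← hgx]
  · rintro ⟨m, hpos, hsum⟩
    obtain ⟨σ, x, hx, hσ⟩ := HasCycleData.exists_of_sum_eq (α := Fin n) hpos (by simpa using hsum)
    exact ⟨Quot.mk _ ⟨(σ, x), hx⟩, Subtype.ext ((hM ⟨(σ, x), hx⟩).unique hσ)⟩
end
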